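/- Pawlikowski's covering-infinitely-often theorem: Let X be a topological space satisfying Menger's property S_fin(O,O). For each strategy for Alice in the Menger game G_fin(O,O) on X, there is a play (U_1, F_1, U_2, F_2, …) according to this strategy such that for each point x ∈ X we have x ∈ ⋃F_n for infinitely many n. -/

import Mathlib

/-- `𝒰` is an open cover of the space `X`. -/
def IsOpenCover {X : Type*} [TopologicalSpace X] (𝒰 : Set (Set X)) : Prop :=
  (∀ U ∈ 𝒰, IsOpen U) ∧ ⋃₀ 𝒰 = Set.univ

/-- Menger's property `S_fin(O,O)`. -/
def MengerSpace (X : Type*) [TopologicalSpace X] : Prop :=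
  ∀ 𝒰 : ℕ → Set (Set X), (∀ n, IsOpenCover (𝒰 n)) →
    ∃ ℱ : ℕ → Set (Set X), (∀ n, (ℱ n).Finite ∧ ℱ n ⊆ 𝒰 n) ∧
      ⋃₀ (⋃ n, ℱ n) = Set.univ

/-- In a Menger space, every open cover is exhausted by an increasing sequence of finite
subfamilies. -/
theorem MengerSpace.exists_monotone_finite {X : Type*} [TopologicalSpace X] (hX : MengerSpace X)
    {𝒰 : Set (Set X)} (h𝒰 : IsOpenCover 𝒰) :
    ∃ G : ℕ → Set (Set X), Monotone G ∧ (∀ n, (G n).Finite ∧ G n ⊆ 𝒰) ∧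
      ∀ x, ∃ n, x ∈ ⋃₀ G n := by
  obtain ⟨ℱ, hℱ, hcov⟩ := hX (fun _ => 𝒰) (fun _ => h𝒰)
  refine ⟨Set.accumulate ℱ, Set.monotone_accumulate, fun n => ⟨?_, ?_⟩, fun x => ?_⟩
  · exact (Set.finite_Iic n).biUnion fun i _ => (hℱ i).1
  · exact Set.iUnion₂_subset fun i _ => (hℱ i).2
  · obtain ⟨V, hV, hx⟩ : x ∈ ⋃₀ (⋃ n, ℱ n) := hcov ▸ Set.mem_univ x
    obtain ⟨n, hn⟩ := Set.mem_iUnion.1 hV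
    exact ⟨n, V, Set.subset_accumulate hn, hx⟩

/-- Bob's moves when he answers the history `h` with `G h m`, where the indices `m` of his answers
are listed from the last one to the first one. -/
def answerHistory {α : Type*} (G : List α → ℕ → α) : List ℕ → List α
  | [] => []
  | m :: l => answerHistory G l ++ [G (answerHistory G l) m]

/-- The set of points covered by Bob's moves `answerHistory G l`. -/
def answerUnion {X : Type*} (G : List (Set (Set X)) → ℕ → Set (Set X)) : List ℕ → Set X
  | [] => ∅
  | m :: l => ⋃₀ G (answerHistory G l) m ∪ answerUnion G l

/-- If Bob's possible answers increase to open covers, then for each `n`, every point has a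
neighborhood that is covered by all but finitely many of the histories of length `n`. -/
theorem exists_open_subset_answerUnion {X : Type*} [TopologicalSpace X]
    {G : List (Set (Set X)) → ℕ → Set (Set X)} (hmono : ∀ h, Monotone (G h))
    (hopen : ∀ h m, ∀ U ∈ G h m, IsOpen U) (hcov : ∀ h x, ∃ m, x ∈ ⋃₀ G h m) (x : X) (n : ℕ) :
    ∃ O : Set X, IsOpen O ∧ x ∈ O ∧ ∃ S : Set (List ℕ), S.Finite ∧
      ∀ l : List ℕ, l.length = n → l ∉ S → O ⊆ answerUnion G l := by
  induction n with
  | zero =>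
    refine ⟨Set.univ, isOpen_univ, Set.mem_univ x, {[]}, Set.finite_singleton _, ?_⟩
    intro l hl hl'
    exact absurd (List.length_eq_zero_iff.1 hl) hl'
  | succ n ih =>
    obtain ⟨O, hO, hxO, S, hS, hOS⟩ := ih
    choose k hk using fun l => hcov (answerHistory G l) x
    refine ⟨O ∩ ⋂ l ∈ S, ⋃₀ G (answerHistory G l) (k l), hO.inter ?_, ⟨hxO, ?_⟩,
      ⋃ l ∈ S, (fun m => m :: l) '' Set.Iio (k l), ?_, ?_⟩
    · exact hS.isOpen_biInter fun l _ => isOpen_sUnion (hopen _ _)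
    · exact Set.mem_iInter₂.2 fun l _ => hk l
    · exact hS.biUnion fun l _ => (Set.finite_Iio _).image _
    · rintro (_ | ⟨m, l⟩) hl hl'
      · simp at hl
      · by_cases hlS : l ∈ S
        · have hm : k l ≤ m := by
            by_contra! hm
            exact hl' (Set.mem_iUnion₂.2 ⟨l, hlS, m, hm, rfl⟩)
          rintro y ⟨-, hy⟩
          exact Or.inl (Set.sUnion_subset_sUnion (hmono _ hm) (Set.mem_iInter₂.1 hy l hlS))
        · rintro y ⟨hy, -⟩
          exact Or.inr (hOS l (by simpa using hl) hlS hy)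

/-- **Hurewicz's theorem.** In a Menger space, no strategy of Alice in the Menger game is
winning. -/
theorem MengerSpace.exists_winning_play {X : Type*} [TopologicalSpace X] (hX : MengerSpace X)
    (strat : List (Set (Set X)) → Set (Set X)) (hstrat : ∀ hist, IsOpenCover (strat hist)) :
    ∃ F : ℕ → Set (Set X),
      (∀ n, (F n).Finite ∧ F n ⊆ strat (List.ofFn fun i : Fin n => F i)) ∧
      ∀ x : X, ∃ n, x ∈ ⋃₀ F n := by
  choose G hmono hG hcov using fun h => hX.exists_monotone_finite (hstrat h)
  have hopen : ∀ h m, ∀ U ∈ G h m, IsOpen U := fun h m U hU => (hstrat h).1 U ((hG h m).2 hU)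
  obtain ⟨ℱ, hℱ, hℱcov⟩ := hX
    (fun n => {O | IsOpen O ∧ ∃ S : Set (List ℕ), S.Finite ∧
      ∀ l : List ℕ, l.length = n + 1 → l ∉ S → O ⊆ answerUnion G l})
    (fun n => ⟨fun _ hO => hO.1, Set.eq_univ_of_forall fun x => by
      obtain ⟨O, hO, hx, hS⟩ := exists_open_subset_answerUnion hmono hopen hcov x (n + 1)
      exact ⟨O, ⟨hO, hS⟩, hx⟩⟩)
  have hS : ∀ n, ∃ S : Set (List ℕ), S.Finite ∧
      ∀ O ∈ ℱ n, ∀ l : List ℕ, l.length = n + 1 → l ∉ S → O ⊆ answerUnion G l := by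
    intro n
    choose! T hT hT' using fun O (hO : O ∈ ℱ n) => ((hℱ n).2 hO).2
    refine ⟨⋃ O ∈ ℱ n, T O, (hℱ n).1.biUnion hT, fun O hO l hl hlT => hT' O hO l hl ?_⟩
    exact fun h => hlT (Set.mem_iUnion₂.2 ⟨O, hO, h⟩)
  choose S hSfin hSsub using hS
  have havoid : ∀ n l, ∃ m : ℕ, m :: l ∉ S n := by
    intro n l
    obtain ⟨m, hm⟩ := ((hSfin n).preimage
      (f := fun m => m :: l) (fun a _ b _ h => (List.cons.inj h).1)).exists_notMem
    exact ⟨m, hm⟩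
  choose m hm using havoid
  let b : ℕ → List ℕ := fun n => Nat.rec [] (fun n l => m n l :: l) n
  have hb : ∀ n, b (n + 1) = m n (b n) :: b n := fun _ => rfl
  have hlen : ∀ n, (b n).length = n := by
    intro n
    induction n with
    | zero => rfl
    | succ n ih => rw [hb, List.length_cons, ih]
  let F : ℕ → Set (Set X) := fun n => G (answerHistory G (b n)) (m n (b n))
  have hhist : ∀ n, answerHistory G (b n) = List.ofFn fun i : Fin n => F i := by
    intro n
    induction n with
    | zero => rfl
    | succ n ih =>
      rw [List.ofFn_succ', List.concat_eq_append, hb, answerHistory]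
      simp only [Fin.val_castSucc, Fin.val_last, ← ih, F]
  have hunion : ∀ n, ∀ x ∈ answerUnion G (b n), ∃ i, x ∈ ⋃₀ F i := by
    intro n x
    induction n with
    | zero => exact False.elim
    | succ n ih =>
      rintro (h | h)
      · exact ⟨n, h⟩
      · exact ih h
  refine ⟨F, fun n => hhist n ▸ hG _ _, fun x => ?_⟩
  obtain ⟨O, hO, hx⟩ : x ∈ ⋃₀ (⋃ n, ℱ n) := hℱcov ▸ Set.mem_univ x
  obtain ⟨n, hn⟩ := Set.mem_iUnion.1 hO
  exact hunion (n + 1) x (hSsub n O hn _ (hlen _) (hm n (b n)) hx)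

/-- The product of a Menger space with the discrete space `ℕ` is a Menger space. -/
theorem MengerSpace.prod_nat {X : Type*} [TopologicalSpace X] (hX : MengerSpace X) :
    MengerSpace (X × ℕ) := by
  intro 𝒰 h𝒰
  have key : ∀ k : ℕ, ∃ ℱ : ℕ → Set (Set (X × ℕ)),
      (∀ n, (ℱ n).Finite ∧ ℱ n ⊆ 𝒰 (n + k)) ∧ ∀ x, ∃ n, (x, k) ∈ ⋃₀ ℱ n := by
    intro k
    obtain ⟨𝒢, h𝒢, hcov⟩ := hX (fun n => (fun U => (fun x => (x, k)) ⁻¹' U) '' 𝒰 (n + k)) (by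
      refine fun n => ⟨?_, Set.eq_univ_of_forall fun x => ?_⟩
      · rintro _ ⟨U, hU, rfl⟩
        exact ((h𝒰 _).1 U hU).preimage (by fun_prop)
      · obtain ⟨U, hU, hx⟩ : (x, k) ∈ ⋃₀ 𝒰 (n + k) := (h𝒰 _).2 ▸ Set.mem_univ _
        exact ⟨_, ⟨U, hU, rfl⟩, hx⟩)
    choose ℱ hsub hfin himg using fun n =>
      Set.exists_subset_image_finite_and.1 ⟨𝒢 n, (h𝒢 n).2, (h𝒢 n).1, rfl⟩
    refine ⟨ℱ, fun n => ⟨hfin n, hsub n⟩, fun x => ?_⟩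
    obtain ⟨V, hV, hx⟩ : x ∈ ⋃₀ (⋃ n, 𝒢 n) := hcov ▸ Set.mem_univ x
    obtain ⟨n, hn⟩ := Set.mem_iUnion.1 hV
    rw [himg n] at hn
    obtain ⟨U, hU, rfl⟩ := hn
    exact ⟨n, U, hU, hx⟩
  choose ℱ hℱ hcov using key
  refine ⟨fun n => ⋃ k ∈ Set.Iic n, ℱ k (n - k), fun n => ⟨?_, ?_⟩, ?_⟩
  · exact (Set.finite_Iic n).biUnion fun k _ => (hℱ k _).1
  · refine Set.iUnion₂_subset fun k hk => ?_
    have h := (hℱ k (n - k)).2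
    rwa [Nat.sub_add_cancel hk] at h
  · refine Set.eq_univ_of_forall fun ⟨x, k⟩ => ?_
    obtain ⟨n, U, hU, hx⟩ := hcov k x
    refine ⟨U, Set.mem_iUnion.2 ⟨n + k, Set.mem_iUnion₂.2 ⟨k, Nat.le_add_left k n, ?_⟩⟩, hx⟩
    rwa [Nat.add_sub_cancel]

/-- **Pawlikowski's covering-infinitely-often theorem.** If `X` satisfies `S_fin(O,O)`, then
for every strategy of Alice in the Menger game `G_fin(O,O)` there is a play according to the
strategy (given by Bob's sequence of legal moves `F`) such that every point of `X` lies in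
`⋃ F n` for infinitely many `n`. -/
theorem pawlikowski_infinitely_often {X : Type*} [TopologicalSpace X] (hX : MengerSpace X)
    (strat : List (Set (Set X)) → Set (Set X))
    (hstrat : ∀ hist, IsOpenCover (strat hist)) :
    ∃ F : ℕ → Set (Set X),
      (∀ n, (F n).Finite ∧ F n ⊆ strat (List.ofFn fun i : Fin n => F i)) ∧
      ∀ x : X, {n : ℕ | x ∈ ⋃₀ F n}.Infinite := by
  -- Every move on `X × ℕ` covers `(x, k)` for only finitely many `k`.
  let π : Set (Set (X × ℕ)) → Set (Set X) := fun 𝒱 => (fun V => Prod.fst '' V) '' 𝒱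
  obtain ⟨F, hF, hcov⟩ := hX.prod_nat.exists_winning_play
    (fun hist => {V | ∃ U ∈ strat (hist.map π), ∃ k : ℕ, V = U ×ˢ {k}}) (by
      refine fun hist => ⟨?_, Set.eq_univ_of_forall fun ⟨x, k⟩ => ?_⟩
      · rintro _ ⟨U, hU, k, rfl⟩
        exact ((hstrat _).1 U hU).prod (isOpen_discrete _)
      · obtain ⟨U, hU, hx⟩ : x ∈ ⋃₀ strat (hist.map π) := (hstrat _).2 ▸ Set.mem_univ x
        exact ⟨U ×ˢ {k}, ⟨U, hU, k, rfl⟩, hx, rfl⟩)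
  refine ⟨fun n => π (F n), fun n => ⟨(hF n).1.image _, ?_⟩, fun x hfin => ?_⟩
  · rintro _ ⟨V, hV, rfl⟩
    obtain ⟨U, hU, k, rfl⟩ := (hF n).2 hV
    rw [List.map_ofFn] at hU
    simpa only [Set.fst_image_prod U (Set.singleton_nonempty k), Function.comp_def] using hU
  · refine Set.infinite_univ (α := ℕ) ((hfin.biUnion (t := fun n => ⋃ V ∈ F n, {k | (x, k) ∈ V})
      fun n _ => (hF n).1.biUnion fun V hV => ?_).subset fun k _ => ?_)
    · obtain ⟨U, -, k, rfl⟩ := (hF n).2 hV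
      exact (Set.finite_singleton k).subset fun j hj => hj.2
    · obtain ⟨n, V, hV, hk⟩ := hcov (x, k)
      exact Set.mem_iUnion₂.2 ⟨n, ⟨_, ⟨V, hV, rfl⟩, (x, k), hk, rfl⟩, Set.mem_iUnion₂.2 ⟨V, hV, hk⟩⟩
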